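/- Let I ⊆ ℝ be a nondegenerate interval whose left endpoint a belongs to I, and let g be strongly operator convex on I. Then the function h defined on I \ {a} by h(x) = (g(x) − g(a))/(x − a) is operator monotone on I \ {a}. -/

import Mathlib

open Matrix Set
open scoped ComplexOrder

/-- `f` is operator monotone on `I ⊆ ℝ`: for every `n ≥ 1` and all `n×n` Hermitian complex
matrices `A, B` with spectra (eigenvalues) contained in `I`, `A ≤ B` in the Loewner order
implies `f(A) ≤ f(B)`, where `f(A)` is given by the functional calculus. -/
def OperatorMonotoneOn (f : ℝ → ℝ) (I : Set ℝ) : Prop :=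
  ∀ (n : ℕ), 0 < n → ∀ (A B : Matrix (Fin n) (Fin n) ℂ)
    (hA : A.IsHermitian) (hB : B.IsHermitian),
    (∀ i, hA.eigenvalues i ∈ I) → (∀ i, hB.eigenvalues i ∈ I) →
    (B - A).PosSemidef → (hB.cfc f - hA.cfc f).PosSemidef

/-- `f` is operator convex on `I ⊆ ℝ`: for every `n ≥ 1`, every `t ∈ [0,1]` and all `n×n`
Hermitian complex matrices `A, B` with spectra contained in `I`,
`f(tA + (1−t)B) ≤ t·f(A) + (1−t)·f(B)` in the Loewner order. -/
def OperatorConvexOn (f : ℝ → ℝ) (I : Set ℝ) : Prop :=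
  ∀ (n : ℕ), 0 < n → ∀ t : ℝ, t ∈ Set.Icc (0 : ℝ) 1 →
  ∀ (A B : Matrix (Fin n) (Fin n) ℂ) (hA : A.IsHermitian) (hB : B.IsHermitian)
    (hAB : ((t : ℂ) • A + ((1 : ℂ) - (t : ℂ)) • B).IsHermitian),
    (∀ i, hA.eigenvalues i ∈ I) → (∀ i, hB.eigenvalues i ∈ I) →
    ((t : ℂ) • hA.cfc f + ((1 : ℂ) - (t : ℂ)) • hB.cfc f - hAB.cfc f).PosSemidef

/-- `f` is strongly operator convex on `I ⊆ ℝ`: there is `x₀ ∈ I` such that for every `n ≥ 1`,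
every `n×n` orthogonal projection `P` and every `n×n` Hermitian matrix `H` with spectrum
contained in `I`, `P·f(PHP + x₀(1−P))·P ≤ f(H)` in the Loewner order. -/
def StronglyOperatorConvexOn (f : ℝ → ℝ) (I : Set ℝ) : Prop :=
  ∃ x₀ ∈ I, ∀ (n : ℕ), 0 < n → ∀ (P H : Matrix (Fin n) (Fin n) ℂ),
    P.IsHermitian → P * P = P →
    ∀ (hH : H.IsHermitian)
      (hK : (P * H * P + (x₀ : ℂ) • ((1 : Matrix (Fin n) (Fin n) ℂ) - P)).IsHermitian),
    (∀ i, hH.eigenvalues i ∈ I) →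
    (hH.cfc f - P * hK.cfc f * P).PosSemidef

namespace Matrix

section FunctionalCalculus

variable {m n : Type*} [Fintype m] [DecidableEq m] [Fintype n] [DecidableEq n]

theorem IsHermitian.cfc_eq_mul {A : Matrix n n ℂ} (hA : A.IsHermitian) (f : ℝ → ℝ) :
    hA.cfc f = (hA.eigenvectorUnitary : Matrix n n ℂ) *
      diagonal (fun i => ((f (hA.eigenvalues i) : ℝ) : ℂ)) *
      (hA.eigenvectorUnitary : Matrix n n ℂ)ᴴ := by
  rw [IsHermitian.cfc, Unitary.conjStarAlgAut_apply]
  rfl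

theorem IsHermitian.cfc_self {A : Matrix n n ℂ} (hA : A.IsHermitian) :
    hA.cfc (fun x => x) = A :=
  hA.spectral_theorem.symm

theorem IsHermitian.eigenvectorUnitary_conjTranspose_mul {A : Matrix n n ℂ}
    (hA : A.IsHermitian) :
    (hA.eigenvectorUnitary : Matrix n n ℂ)ᴴ * (hA.eigenvectorUnitary : Matrix n n ℂ) = 1 :=
  Unitary.coe_star_mul_self _

theorem IsHermitian.eigenvectorUnitary_mul_conjTranspose {A : Matrix n n ℂ}
    (hA : A.IsHermitian) :
    (hA.eigenvectorUnitary : Matrix n n ℂ) * (hA.eigenvectorUnitary : Matrix n n ℂ)ᴴ = 1 :=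
  Unitary.coe_mul_star_self _

theorem IsHermitian.cfc_mul {A : Matrix n n ℂ} (hA : A.IsHermitian) (f g : ℝ → ℝ) :
    hA.cfc f * hA.cfc g = hA.cfc (fun x => f x * g x) := by
  simp only [hA.cfc_eq_mul, Matrix.mul_assoc]
  rw [← Matrix.mul_assoc (_ᴴ) _ (_ * _), hA.eigenvectorUnitary_conjTranspose_mul,
    Matrix.one_mul, ← Matrix.mul_assoc (diagonal _) (diagonal _), diagonal_mul_diagonal]
  simp

theorem IsHermitian.cfc_sub_const {A : Matrix n n ℂ} (hA : A.IsHermitian) (f : ℝ → ℝ) (c : ℝ) :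
    hA.cfc (fun x => f x - c) = hA.cfc f - (c : ℂ) • 1 := by
  have h : diagonal (fun i => ((f (hA.eigenvalues i) - c : ℝ) : ℂ)) =
      diagonal (fun i => ((f (hA.eigenvalues i) : ℝ) : ℂ)) - (c : ℂ) • (1 : Matrix n n ℂ) := by
    rw [smul_one_eq_diagonal, diagonal_sub]
    simp
  rw [hA.cfc_eq_mul, h, hA.cfc_eq_mul, Matrix.mul_sub, Matrix.sub_mul, Matrix.mul_smul,
    Matrix.mul_one, Matrix.smul_mul, hA.eigenvectorUnitary_mul_conjTranspose]

theorem IsHermitian.cfc_eq_one {A : Matrix n n ℂ} (hA : A.IsHermitian) {f : ℝ → ℝ}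
    (hf : ∀ i, f (hA.eigenvalues i) = 1) : hA.cfc f = 1 := by
  simp [hA.cfc_eq_mul, hf, hA.eigenvectorUnitary_mul_conjTranspose]

theorem IsHermitian.cfc_eq_zero_iff {A : Matrix n n ℂ} (hA : A.IsHermitian) {f : ℝ → ℝ} :
    hA.cfc f = 0 ↔ ∀ i, f (hA.eigenvalues i) = 0 := by
  refine ⟨fun h i => ?_, fun h => by simp [hA.cfc_eq_mul, h]⟩
  have h' : (hA.eigenvectorUnitary : Matrix n n ℂ)ᴴ * hA.cfc f *
      (hA.eigenvectorUnitary : Matrix n n ℂ) = 0 := by simp [h]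
  rw [hA.cfc_eq_mul, Matrix.mul_assoc, Matrix.mul_assoc, Matrix.mul_assoc,
    hA.eigenvectorUnitary_conjTranspose_mul, Matrix.mul_one, ← Matrix.mul_assoc,
    hA.eigenvectorUnitary_conjTranspose_mul, Matrix.one_mul] at h'
  have := congrFun (congrFun h' i) i
  simpa using this

theorem IsHermitian.cfc_congr {A : Matrix n n ℂ} (hA : A.IsHermitian) {f g : ℝ → ℝ}
    (h : ∀ i, f (hA.eigenvalues i) = g (hA.eigenvalues i)) : hA.cfc f = hA.cfc g := by
  simp [hA.cfc_eq_mul, h]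

theorem IsHermitian.cfc_isHermitian {A : Matrix n n ℂ} (hA : A.IsHermitian) (f : ℝ → ℝ) :
    (hA.cfc f).IsHermitian := by
  rw [hA.cfc_eq_mul]
  refine isHermitian_mul_mul_conjTranspose _ ?_
  rw [isHermitian_diagonal_iff]
  intro i
  simp [IsSelfAdjoint]

/-- The functional calculus respects intertwiners between Hermitian matrices. -/
theorem IsHermitian.cfc_mul_eq_mul_cfc {A : Matrix m m ℂ} {B : Matrix n n ℂ}
    (hA : A.IsHermitian) (hB : B.IsHermitian) {W : Matrix m n ℂ} (hW : A * W = W * B)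
    (f : ℝ → ℝ) : hA.cfc f * W = W * hB.cfc f := by
  set U : Matrix m m ℂ := (hA.eigenvectorUnitary : Matrix m m ℂ) with hU
  set U' : Matrix n n ℂ := (hB.eigenvectorUnitary : Matrix n n ℂ) with hU'
  have hUU : Uᴴ * U = 1 := hA.eigenvectorUnitary_conjTranspose_mul
  have hUU2 : U * Uᴴ = 1 := hA.eigenvectorUnitary_mul_conjTranspose
  have hVV : U'ᴴ * U' = 1 := hB.eigenvectorUnitary_conjTranspose_mul
  have hVV2 : U' * U'ᴴ = 1 := hB.eigenvectorUnitary_mul_conjTranspose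
  have key (k : ℝ → ℝ) : hA.cfc k * W = W * hB.cfc k ↔
      diagonal (fun i => ((k (hA.eigenvalues i) : ℝ) : ℂ)) * (Uᴴ * W * U') =
        (Uᴴ * W * U') * diagonal (fun i => ((k (hB.eigenvalues i) : ℝ) : ℂ)) := by
    rw [hA.cfc_eq_mul, hB.cfc_eq_mul, ← hU, ← hU']
    constructor
    · intro h
      have h2 := congrArg (fun Z => Uᴴ * Z * U') h
      simp only [Matrix.mul_assoc, hVV, Matrix.mul_one] at h2
      rw [← Matrix.mul_assoc Uᴴ U, hUU, Matrix.one_mul] at h2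
      simpa only [Matrix.mul_assoc] using h2
    · intro h
      have h2 := congrArg (fun Z => U * Z * U'ᴴ) h
      simp only [Matrix.mul_assoc, hVV2, Matrix.mul_one] at h2
      rw [← Matrix.mul_assoc U Uᴴ, hUU2, Matrix.one_mul] at h2
      simpa only [Matrix.mul_assoc] using h2
  have hid := (key fun x => x).1 (by rw [hA.cfc_self, hB.cfc_self, hW])
  rw [key]
  ext i j
  have hij := congrFun (congrFun hid i) j
  rw [diagonal_mul, mul_diagonal] at hij ⊢
  by_cases hz : (Uᴴ * W * U') i j = 0
  · rw [hz, mul_zero, zero_mul]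
  · rw [mul_comm] at hij
    have := Complex.ofReal_injective (mul_left_cancel₀ hz hij)
    rw [this, mul_comm]

end FunctionalCalculus

/-- If `X Xᴴ ≤ 1` then `Xᴴ X ≤ 1`. -/
theorem posSemidef_one_sub_conjTranspose_mul_self {n : Type*} [Fintype n] [DecidableEq n]
    {X : Matrix n n ℂ} (h : (1 - X * Xᴴ).PosSemidef) : (1 - Xᴴ * X).PosSemidef := by
  have h1 := posSemidef_conjTranspose_mul_self (1 - Xᴴ * X)
  have h2 := h.conjTranspose_mul_mul_same X
  convert h1.add h2 using 1
  simp only [conjTranspose_sub, conjTranspose_one, conjTranspose_mul, conjTranspose_conjTranspose]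
  noncomm_ring

end Matrix

open Matrix

/-- Jensen's inequality for compressions by isometries. -/
theorem StronglyOperatorConvexOn.posSemidef_compression {I : Set ℝ} {g : ℝ → ℝ}
    (hg : StronglyOperatorConvexOn g I) {m n : ℕ} (hm : 0 < m)
    {H : Matrix (Fin m) (Fin m) ℂ} (hH : H.IsHermitian) (hI : ∀ i, hH.eigenvalues i ∈ I)
    {V : Matrix (Fin m) (Fin n) ℂ} (hV : Vᴴ * V = 1) {K : Matrix (Fin n) (Fin n) ℂ}
    (hK : K.IsHermitian) (hKV : Vᴴ * H * V = K) :
    (Vᴴ * hH.cfc g * V - hK.cfc g).PosSemidef := by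
  obtain ⟨x₀, -, h⟩ := hg
  have hP : (V * Vᴴ).IsHermitian := isHermitian_mul_conjTranspose_self V
  have hPV : V * Vᴴ * V = V := by rw [Matrix.mul_assoc, hV, Matrix.mul_one]
  have hVP : Vᴴ * (V * Vᴴ) = Vᴴ := by rw [← Matrix.mul_assoc, hV, Matrix.one_mul]
  have hM : (V * Vᴴ * H * (V * Vᴴ) + (x₀ : ℂ) • (1 - V * Vᴴ)).IsHermitian := by
    refine IsHermitian.add ?_ ?_
    · have := isHermitian_mul_mul_conjTranspose (V * Vᴴ) hH
      rwa [hP.eq] at this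
    · simp [IsHermitian, conjTranspose_smul]
  have hMV : (V * Vᴴ * H * (V * Vᴴ) + (x₀ : ℂ) • (1 - V * Vᴴ)) * V = V * K := by
    rw [Matrix.add_mul, Matrix.smul_mul, Matrix.sub_mul, hPV, Matrix.one_mul, sub_self,
      smul_zero, add_zero, Matrix.mul_assoc, hPV, ← hKV]
    simp only [Matrix.mul_assoc]
  have h1 := (h m hm (V * Vᴴ) H hP (by rw [← Matrix.mul_assoc, hPV]) hH hM
    hI).conjTranspose_mul_mul_same V
  have h2 : Vᴴ * (V * Vᴴ * hM.cfc g * (V * Vᴴ)) * V = hK.cfc g := by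
    rw [Matrix.mul_assoc, Matrix.mul_assoc _ (V * Vᴴ) V, hPV, Matrix.mul_assoc,
      hM.cfc_mul_eq_mul_cfc hK hMV, ← Matrix.mul_assoc (V * Vᴴ), hPV, ← Matrix.mul_assoc, hV,
      Matrix.one_mul]
  rwa [Matrix.mul_sub, Matrix.sub_mul, h2] at h1

/-- Jensen's inequality for contractions, with the defect filled by a point `a`. -/
theorem StronglyOperatorConvexOn.posSemidef_contraction {I : Set ℝ} {g : ℝ → ℝ}
    (hg : StronglyOperatorConvexOn g I) {a : ℝ} (ha : a ∈ I) {n : ℕ} (hn : 0 < n)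
    {A B X : Matrix (Fin n) (Fin n) ℂ} (hA : A.IsHermitian) (hB : B.IsHermitian)
    (hI : ∀ i, hB.eigenvalues i ∈ I) (hX : (1 - Xᴴ * X).PosSemidef)
    (hAX : Xᴴ * B * X + (a : ℂ) • (1 - Xᴴ * X) = A) :
    (Xᴴ * hB.cfc g * X + (g a : ℂ) • (1 - Xᴴ * X) - hA.cfc g).PosSemidef := by
  obtain ⟨Y, hY⟩ : ∃ Y : Matrix (Fin n) (Fin n) ℂ, 1 - Xᴴ * X = Yᴴ * Y := by
    open scoped MatrixOrder in
    obtain ⟨Y, hY⟩ := CStarAlgebra.nonneg_iff_eq_star_mul_self.mp hX.nonneg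
    exact ⟨Y, hY⟩
  set J : Matrix (Fin (n + n)) (Fin n) ℂ := (1 : Matrix _ _ ℂ).submatrix id (Fin.castAdd n)
    with hJ
  set L : Matrix (Fin (n + n)) (Fin n) ℂ := (1 : Matrix _ _ ℂ).submatrix id (Fin.natAdd n)
    with hL
  have hJJ : Jᴴ * J = 1 := by
    ext i j
    simp [hJ, mul_apply, one_apply, -Fin.natAdd_eq_addNat]
  have hLL : Lᴴ * L = 1 := by
    ext i j
    simp [hL, mul_apply, one_apply, -Fin.natAdd_eq_addNat]
  have hne (i j : Fin n) : Fin.castAdd n i ≠ Fin.natAdd n j := by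
    rw [Ne, Fin.ext_iff, Fin.val_castAdd, Fin.val_natAdd]
    omega
  have hJL : Jᴴ * L = 0 := by
    ext i j
    simp [hJ, hL, mul_apply, one_apply, hne, -Fin.natAdd_eq_addNat]
  have hLJ : Lᴴ * J = 0 := by
    simpa using congrArg conjTranspose hJL
  have hsum : J * Jᴴ + L * Lᴴ = 1 := by
    ext i j
    refine Fin.addCases (fun i => ?_) (fun i => ?_) i <;>
    refine Fin.addCases (fun j => ?_) (fun j => ?_) j <;>
    simp [hJ, hL, mul_apply, one_apply, hne, (hne _ _).symm, -Fin.natAdd_eq_addNat]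
  have hC : ((a : ℂ) • (1 : Matrix (Fin n) (Fin n) ℂ)).IsHermitian := by
    simp [IsHermitian, conjTranspose_smul]
  have hCg (f : ℝ → ℝ) : hC.cfc f = (f a : ℂ) • 1 := by
    have h0 : hC.cfc (fun x => x - a) = 0 := by
      rw [hC.cfc_sub_const, hC.cfc_self, sub_self]
    have h1 : ∀ i, hC.eigenvalues i = a := fun i => sub_eq_zero.1 (hC.cfc_eq_zero_iff.1 h0 i)
    rw [← sub_eq_zero, ← hC.cfc_sub_const, hC.cfc_eq_zero_iff]
    simp [h1]
  set H : Matrix (Fin (n + n)) (Fin (n + n)) ℂ := J * B * Jᴴ + L * ((a : ℂ) • (1 : Matrix (Fin n) (Fin n) ℂ)) * Lᴴ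
    with hHdef
  have hH : H.IsHermitian :=
    (isHermitian_mul_mul_conjTranspose J hB).add (isHermitian_mul_mul_conjTranspose L hC)
  have hHJ : H * J = J * B := by
    simp [hHdef, Matrix.add_mul, Matrix.mul_assoc, hJJ, hLJ]
  have hHL : H * L = L * ((a : ℂ) • (1 : Matrix (Fin n) (Fin n) ℂ)) := by
    simp [hHdef, Matrix.add_mul, Matrix.mul_assoc, hJL, hLL]
  have hfJ (f : ℝ → ℝ) := hH.cfc_mul_eq_mul_cfc hB hHJ f
  have hfL (f : ℝ → ℝ) := hH.cfc_mul_eq_mul_cfc hC hHL f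
  have hHI : ∀ i, hH.eigenvalues i ∈ I := by
    classical
    have h0 : hH.cfc (fun x => if x ∈ I then 0 else 1) = 0 := by
      rw [← Matrix.mul_one (hH.cfc _), ← hsum, Matrix.mul_add, ← Matrix.mul_assoc,
        ← Matrix.mul_assoc, hfJ, hfL, hCg, hB.cfc_eq_zero_iff.2 (by simp [hI])]
      simp [ha]
    simpa using hH.cfc_eq_zero_iff.1 h0
  set V := J * X + L * Y with hVdef
  have hcomp (Z : Matrix (Fin (n + n)) (Fin (n + n)) ℂ) (S T : Matrix (Fin n) (Fin n) ℂ)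
      (hS : Z * J = J * S) (hT : Z * L = L * T) :
      Vᴴ * Z * V = Xᴴ * S * X + Yᴴ * T * Y := by
    have hZV : Z * V = J * (S * X) + L * (T * Y) := by
      rw [hVdef, Matrix.mul_add, ← Matrix.mul_assoc, ← Matrix.mul_assoc, hS, hT,
        Matrix.mul_assoc, Matrix.mul_assoc]
    rw [Matrix.mul_assoc, hZV, hVdef, conjTranspose_add, conjTranspose_mul, conjTranspose_mul,
      Matrix.add_mul, Matrix.mul_add, Matrix.mul_add]
    simp only [Matrix.mul_assoc]
    rw [← Matrix.mul_assoc Jᴴ J, ← Matrix.mul_assoc Jᴴ L, ← Matrix.mul_assoc Lᴴ J,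
      ← Matrix.mul_assoc Lᴴ L, hJJ, hJL, hLJ, hLL]
    simp
  have hV : Vᴴ * V = 1 := by
    have := hcomp 1 1 1 (by simp) (by simp)
    simpa [← hY] using this
  have hK : Vᴴ * H * V = A := by
    rw [hcomp H _ _ hHJ hHL, ← hAX, hY]
    simp
  have := hg.posSemidef_compression (by omega) hH hHI hV hA hK
  rw [hcomp _ _ _ (hfJ g) (hfL g), hCg] at this
  simpa [hY] using this

/-- if `g` is strongly operator convex on a nondegenerate interval `I` whose
left endpoint `a` belongs to `I`, then `h(x) = (g(x) − g(a))/(x − a)` is operator monotone on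
`I \ {a}`. -/
theorem stmt18 (I : Set ℝ) (hI : Convex ℝ I) (hnt : I.Nontrivial)
    (a : ℝ) (ha : a ∈ I) (hleft : ∀ x ∈ I, a ≤ x)
    (g : ℝ → ℝ) (hg : StronglyOperatorConvexOn g I) :
    OperatorMonotoneOn (fun x => (g x - g a) / (x - a)) (I \ {a}) := by
  intro n hn A B hA hB hAI hBI hAB
  have hpos {x : ℝ} (hx : x ∈ I \ {a}) : 0 < x - a :=
    sub_pos.2 (lt_of_le_of_ne (hleft x hx.1) fun h => hx.2 h.symm)
  set R := hA.cfc (fun x => √(x - a)) with hR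
  set T := hA.cfc (fun x => (√(x - a))⁻¹) with hT
  set S := hB.cfc (fun x => (√(x - a))⁻¹) with hS
  have hRh : Rᴴ = R := hA.cfc_isHermitian _
  have hTh : Tᴴ = T := hA.cfc_isHermitian _
  have hSh : Sᴴ = S := hB.cfc_isHermitian _
  have hRT : R * T = 1 := by
    rw [hR, hT, hA.cfc_mul]
    exact hA.cfc_eq_one fun i => mul_inv_cancel₀ (Real.sqrt_pos.2 (hpos (hAI i))).ne'
  have hTR : T * R = 1 := by
    rw [hR, hT, hA.cfc_mul]
    exact hA.cfc_eq_one fun i => inv_mul_cancel₀ (Real.sqrt_pos.2 (hpos (hAI i))).ne'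
  have hRR : R * R = A - (a : ℂ) • 1 := by
    rw [hR, hA.cfc_mul, hA.cfc_congr (g := fun x => x - a)
      fun i => Real.mul_self_sqrt (hpos (hAI i)).le, hA.cfc_sub_const, hA.cfc_self]
  have hSBS : S * (B - (a : ℂ) • 1) * S = 1 := by
    rw [← congrArg (· - (a : ℂ) • (1 : Matrix (Fin n) (Fin n) ℂ)) hB.cfc_self,
      ← hB.cfc_sub_const, hS, hB.cfc_mul, hB.cfc_mul]
    refine hB.cfc_eq_one fun i => ?_
    have h := Real.sqrt_pos.2 (hpos (hBI i))
    nth_rewrite 2 [← Real.mul_self_sqrt (hpos (hBI i)).le]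
    field_simp
  have hSgS : S * (hB.cfc g - (g a : ℂ) • 1) * S =
      hB.cfc (fun x => (g x - g a) / (x - a)) := by
    rw [← hB.cfc_sub_const, hS, hB.cfc_mul, hB.cfc_mul]
    refine hB.cfc_congr fun i => ?_
    have h := Real.sqrt_pos.2 (hpos (hBI i))
    nth_rewrite 3 [← Real.mul_self_sqrt (hpos (hBI i)).le]
    field_simp
  have hTgT : T * (hA.cfc g - (g a : ℂ) • 1) * T =
      hA.cfc (fun x => (g x - g a) / (x - a)) := by
    rw [← hA.cfc_sub_const, hT, hA.cfc_mul, hA.cfc_mul]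
    refine hA.cfc_congr fun i => ?_
    have h := Real.sqrt_pos.2 (hpos (hAI i))
    nth_rewrite 3 [← Real.mul_self_sqrt (hpos (hAI i)).le]
    field_simp
  have hXh : (S * R)ᴴ = R * S := by rw [conjTranspose_mul, hRh, hSh]
  have hX : (1 - (S * R)ᴴ * (S * R)).PosSemidef := by
    refine posSemidef_one_sub_conjTranspose_mul_self ?_
    have h := hAB.conjTranspose_mul_mul_same S
    have e : 1 - S * R * (S * R)ᴴ = Sᴴ * (B - A) * S := by
      calc 1 - S * R * (S * R)ᴴ = S * (B - (a : ℂ) • 1) * S - S * (R * R) * S := by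
            rw [hSBS, hXh]; noncomm_ring
        _ = Sᴴ * (B - A) * S := by rw [hRR, hSh]; noncomm_ring
    rwa [e]
  have hAX : (S * R)ᴴ * B * (S * R) + (a : ℂ) • (1 - (S * R)ᴴ * (S * R)) = A := by
    calc (S * R)ᴴ * B * (S * R) + (a : ℂ) • (1 - (S * R)ᴴ * (S * R))
        = R * (S * (B - (a : ℂ) • 1) * S) * R + (a : ℂ) • 1 := by
          rw [hXh]
          simp only [Matrix.mul_sub, Matrix.sub_mul, Matrix.mul_assoc, Matrix.smul_mul,
            Matrix.mul_smul, Matrix.one_mul, smul_sub]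
          abel
      _ = A := by rw [hSBS, Matrix.mul_one, hRR, sub_add_cancel]
  have h := (hg.posSemidef_contraction ha hn hA hB (fun i => (hBI i).1) hX
    hAX).conjTranspose_mul_mul_same T
  convert h using 1
  rw [← hSgS, ← hTgT, hTh, hXh]
  calc S * (hB.cfc g - (g a : ℂ) • 1) * S - T * (hA.cfc g - (g a : ℂ) • 1) * T
      = (T * R) * (S * (hB.cfc g - (g a : ℂ) • 1) * S) * (R * T)
        - T * (hA.cfc g - (g a : ℂ) • 1) * T := by rw [hTR, hRT, Matrix.one_mul, Matrix.mul_one]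
    _ = _ := by
      simp only [Matrix.mul_sub, Matrix.sub_mul, Matrix.mul_add, Matrix.add_mul,
        Matrix.mul_assoc, Matrix.smul_mul, Matrix.mul_smul, Matrix.mul_one,
        smul_sub]
      abel
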